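/- arXiv:1910.08551 — 2 statements merged into one kernel-verified Lean document; each statement's English description precedes it below -/
import Mathlib

section
/- The baxterized elements σ_i^{ε}(x) := 1 + ((x−1)/(q−q^{-1})) σ_i + ((x−1)/(α_ε x + 1)) κ_i of the BMW algebra, with α_ε := −ε q^{−ε} μ^{-1} and ε = ±1, satisfy the shifted Yang–Baxter equation σ_i^{ε}(x) σ_{i+1}^{ε}(xy) σ_i^{ε}(y) = σ_{i+1}^{ε}(y) σ_i^{ε}(xy) σ_{i+1}^{ε}(x). -/
/-- Relations of one half of the BMW algebra on three strands; the other half follows by symmetry. -/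
theorem bmw_half {A : Type*} [Ring A] [Algebra ℂ A] (l μ : ℂ) (hl : l ≠ 0) (hμ : μ ≠ 0)
    (a b a' b' k m : A)
    (hb : b * b' = 1) (hb2 : b' * b = 1) (ha : a * a' = 1) (ha2 : a' * a = 1)
    (hk : (μ * l) • k = 1 + l • a - a * a) (hm : (μ * l) • m = 1 + l • b - b * b)
    (hbr : a * b * a = b * a * b)
    (hak : a * k = μ • k) (hka : k * a = μ • k)
    (hbm : b * m = μ • m) (hmb : m * b = μ • m)
    (hkbk : k * (b * k) = μ⁻¹ • k) (hkbk' : k * (b' * k) = μ • k)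
    (hmam : m * (a * m) = μ⁻¹ • m) :
    b' = b - l • 1 + l • m ∧
    k * k = ((μ⁻¹ + l - μ) / l) • k ∧ k * m * k = k ∧ a * b * k = m * (a * b) ∧
    k * (b * a) = b * a * m ∧ k * b * a = k * m := by
  have hμl : μ * l ≠ 0 := mul_ne_zero hμ hl
  have hmb' : m * b' = μ⁻¹ • m := by
    have h : m * b * b' = m := by rw [mul_assoc, hb, mul_one]
    rw [hmb, smul_mul_assoc] at h
    rw [← h, smul_smul, inv_mul_cancel₀ hμ, one_smul, h]
  have e1 : b' = b - l • 1 + l • m := by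
    have h := congrArg (· * b') hm
    simp only [add_mul, sub_mul, smul_mul_assoc, mul_assoc, hb, hmb', one_mul, mul_one,
      smul_smul] at h
    have h2 : μ * (l * μ⁻¹) = l := by field_simp
    rw [h2] at h
    rw [h]; abel
  have e2 : k * k = ((μ⁻¹ + l - μ) / l) • k := by
    have h := congrArg (k * ·) hk
    simp only [mul_add, mul_sub, mul_smul_comm, mul_one, ← mul_assoc, hka, smul_mul_assoc] at h
    have h3 := congrArg ((μ * l)⁻¹ • ·) h
    simp only [smul_smul, inv_mul_cancel₀ hμl, one_smul] at h3
    rw [h3]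
    match_scalars
    field_simp
  have e3 : k * m * k = k := by
    rw [e1] at hkbk'
    simp only [mul_add, add_mul, mul_sub, sub_mul, smul_mul_assoc, mul_smul_comm, one_mul,
      hkbk, e2] at hkbk'
    have h : l • (k * (m * k)) = l • k := by
      have : l • (k * (m * k)) = μ • k - (μ⁻¹ • k - l • ((μ⁻¹ + l - μ) / l) • k) := by
        rw [← hkbk']; abel
      rw [this]
      match_scalars
      field_simp
      ring
    have h3 := congrArg (l⁻¹ • ·) h
    simp only [smul_smul, inv_mul_cancel₀ hl, one_smul] at h3
    rw [mul_assoc, h3]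
  have e4 : a * b * k = m * (a * b) := by
    have h : (μ * l) • (a * b * k) = (μ * l) • (m * (a * b)) := by
      rw [← mul_smul_comm, ← smul_mul_assoc, hk, hm]
      have h1 : a * b * (a * a) = b * b * (a * b) := by
        calc a * b * (a * a) = (a * b * a) * a := by noncomm_ring
          _ = b * (a * b * a) := by nth_rewrite 1 [hbr]; noncomm_ring
          _ = _ := by rw [hbr]; noncomm_ring
      simp only [mul_add, add_mul, mul_sub, sub_mul, smul_mul_assoc, mul_smul_comm, one_mul,
        mul_one, h1]
      rw [hbr]; simp only [mul_assoc]
    have h3 := congrArg ((μ * l)⁻¹ • ·) h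
    simpa only [smul_smul, inv_mul_cancel₀ hμl, one_smul] using h3
  have e5 : k * (b * a) = b * a * m := by
    have h : (μ * l) • (k * (b * a)) = (μ * l) • (b * a * m) := by
      rw [← smul_mul_assoc, ← mul_smul_comm, hk, hm]
      have h1 : a * a * (b * a) = b * a * (b * b) := by
        calc a * a * (b * a) = a * (a * b * a) := by noncomm_ring
          _ = (a * b * a) * b := by nth_rewrite 1 [hbr]; noncomm_ring
          _ = _ := by rw [hbr]; noncomm_ring
      simp only [mul_add, add_mul, mul_sub, sub_mul, smul_mul_assoc, mul_smul_comm, one_mul,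
        mul_one, h1]
      rw [← mul_assoc a b a, hbr]
    have h3 := congrArg ((μ * l)⁻¹ • ·) h
    simpa only [smul_smul, inv_mul_cancel₀ hμl, one_smul] using h3
  have e6 : k * b * a = k * m := by
    calc k * b * a = k * m * k * b * a := by rw [e3]
      _ = k * m * (k * (b * a)) := by noncomm_ring
      _ = k * (m * b) * (a * m) := by rw [e5]; noncomm_ring
      _ = μ • (k * (m * (a * m))) := by rw [hmb]; simp [mul_assoc]
      _ = k * m := by rw [hmam, mul_smul_comm, smul_smul, mul_inv_cancel₀ hμ, one_smul]
  exact ⟨e1, e2, e3, e4, e5, e6⟩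

/-- The Yang-Baxter equation for two neighbouring generators. -/
theorem bmw_core {A : Type*} [Ring A] [Algebra ℂ A] (l μ α x y : ℂ) (hl : l ≠ 0) (hμ : μ ≠ 0)
    (hx : α * x + 1 ≠ 0) (hy : α * y + 1 ≠ 0) (hxy : α * (x * y) + 1 ≠ 0)
    (hα : α ^ 2 * μ ^ 2 = l * μ * α + 1)
    (a b a' b' k m : A)
    (hb : b * b' = 1) (hb2 : b' * b = 1) (ha : a * a' = 1) (ha2 : a' * a = 1)
    (hk : (μ * l) • k = 1 + l • a - a * a) (hm : (μ * l) • m = 1 + l • b - b * b)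
    (hbr : a * b * a = b * a * b)
    (hak : a * k = μ • k) (hka : k * a = μ • k)
    (hbm : b * m = μ • m) (hmb : m * b = μ • m)
    (hkbk : k * (b * k) = μ⁻¹ • k) (hkbk' : k * (b' * k) = μ • k)
    (hmam : m * (a * m) = μ⁻¹ • m) (hmam' : m * (a' * m) = μ • m) :
    (1 + ((x - 1) / l) • a + ((x - 1) / (α * x + 1)) • k) *
    (1 + ((x * y - 1) / l) • b + ((x * y - 1) / (α * (x * y) + 1)) • m) *
    (1 + ((y - 1) / l) • a + ((y - 1) / (α * y + 1)) • k) =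
    (1 + ((y - 1) / l) • b + ((y - 1) / (α * y + 1)) • m) *
    (1 + ((x * y - 1) / l) • a + ((x * y - 1) / (α * (x * y) + 1)) • k) *
    (1 + ((x - 1) / l) • b + ((x - 1) / (α * x + 1)) • m) := by
  obtain ⟨e1, e2, e3, e4, e5, e6⟩ := bmw_half l μ hl hμ a b a' b' k m hb hb2 ha ha2 hk hm hbr
    hak hka hbm hmb hkbk hkbk' hmam
  obtain ⟨f1, f2, f3, f4, f5, f6⟩ := bmw_half l μ hl hμ b a b' a' m k ha ha2 hb hb2 hm hk hbr.symm
    hbm hmb hak hka hmam hmam' hkbk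
  have haa : a * a = 1 + l • a - (μ * l) • k := by rw [hk]; abel
  have hbb : b * b = 1 + l • b - (μ * l) • m := by rw [hm]; abel
  -- the words with one κ at an end
  have g1 : a * b * k = m * k := by rw [e4, ← mul_assoc, f6]
  have g2 : b * a * m = k * m := by rw [f4, ← mul_assoc, e6]
  have kbk : k * b * k = μ⁻¹ • k := by rw [mul_assoc, hkbk]
  have mam : m * a * m = μ⁻¹ • m := by rw [mul_assoc, hmam]
  -- the words with two neighbouring κ
  have mkb' : m * k * b' = m * a := by rw [← f6, mul_assoc, hb, mul_one]
  have kma' : k * m * a' = k * b := by rw [← e6, mul_assoc, ha, mul_one]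
  have a'mk : a' * (m * k) = b * k := by
    rw [← g1, ← mul_assoc, ← mul_assoc, ha2, one_mul]
  have b'km : b' * (k * m) = a * m := by
    rw [← g2, ← mul_assoc, ← mul_assoc, hb2, one_mul]
  have mkm : m * k * m = m := f3
  have bkm : b * k * m = a * m - l • m + l • (k * m) := by
    calc b * k * m = a' * (m * k) * m := by rw [a'mk]
      _ = a' * (m * k * m) := by noncomm_ring
      _ = _ := by rw [mkm, f1]; simp [add_mul, sub_mul]
  have amk : a * m * k = b * k - l • k + l • (m * k) := by
    calc a * m * k = b' * (k * m) * k := by rw [b'km]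
      _ = b' * (k * m * k) := by noncomm_ring
      _ = _ := by rw [e3, e1]; simp [add_mul, sub_mul]
  have mkb : m * k * b = m * a - l • m + l • (m * k) := by
    calc m * k * b = m * (k * b) := by noncomm_ring
      _ = m * k * m * a' := by rw [← kma']; noncomm_ring
      _ = _ := by rw [mkm, f1]; simp [mul_add, mul_sub]
  have kma : k * m * a = k * b - l • k + l • (k * m) := by
    calc k * m * a = k * (m * a) := by noncomm_ring
      _ = k * m * k * b' := by rw [← mkb']; noncomm_ring
      _ = _ := by rw [e3, e1]; simp [mul_add, mul_sub]
  have ama' : a' * m * a = b * k * b' := by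
    calc a' * m * a = a' * (m * (a * b)) * b' := by
          rw [mul_assoc a', mul_assoc a', mul_assoc m, mul_assoc a, hb, mul_one]
      _ = b * k * b' := by rw [← e4, mul_assoc a, ← mul_assoc a', ha2, one_mul]
  have ama : a * m * a = b * k * b - l • (b * k) - l • (k * b) + l • (a * m) + l • (m * a)
      + (l * l) • k - (l * l) • m := by
    have h := ama'
    rw [f1, e1] at h
    simp only [mul_add, mul_sub, add_mul, sub_mul, smul_mul_assoc, mul_smul_comm, one_mul, mul_one,
      bkm, kma] at h
    have h2 : a * m * a = (a * m * a - l • (m * a) + l • (k * b - l • k + l • (k * m)))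
      + l • (m * a) - l • (k * b - l • k + l • (k * m)) := by abel
    rw [h2, h]
    module
  simp only [mul_add, add_mul, smul_mul_assoc, mul_smul_comm, one_mul, mul_one]
  simp only [haa, hbb, hak, hka, hbm, hmb, e2, f2, e3, f3, hbr, g1, g2, e6, f6, kbk, mam, bkm, amk,
    mkb, kma, ama]
  obtain ⟨u, hu⟩ : ∃ u, u = α * x + 1 := ⟨_, rfl⟩
  obtain ⟨v, hv⟩ : ∃ v, v = α * y + 1 := ⟨_, rfl⟩
  obtain ⟨w, hw⟩ : ∃ w, w = α * (x * y) + 1 := ⟨_, rfl⟩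
  rw [← hu] at hx
  rw [← hv] at hy
  rw [← hw] at hxy
  rw [← hu, ← hv, ← hw]
  match_scalars
  all_goals field_simp
  all_goals try simp only [hu, hv, hw]
  all_goals first
    | ring1
    | linear_combination (-((x - 1) * (y - 1) * x * y * (α * (x * y) + 1))) * hα
    | linear_combination ((x - 1) * (y - 1) * x * y * (α * (x * y) + 1)) * hα

/-- Baxterized elements of the BMW algebra satisfy the shifted Yang–Baxter equation. -/
theorem bmw_baxterized_yang_baxter
    {A : Type*} [Ring A] [Algebra ℂ A] (n : ℕ) (q μ : ℂ)
    (hq0 : q ≠ 0) (hq1 : q ≠ 1) (hq2 : q ≠ -1)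
    (hμ0 : μ ≠ 0) (hμ1 : μ ≠ q) (hμ2 : μ ≠ -q⁻¹)
    (σ σinv : ℕ → A) (κ : ℕ → A)
    (hinv : ∀ i, 1 ≤ i → i ≤ n - 1 → σ i * σinv i = 1 ∧ σinv i * σ i = 1)
    (hκ : ∀ i, 1 ≤ i → i ≤ n - 1 →
      κ i = (μ * (q - q⁻¹))⁻¹ • ((q • (1 : A) - σ i) * (q⁻¹ • (1 : A) + σ i)))
    (hbraid : ∀ i, 1 ≤ i → i + 1 ≤ n - 1 →
      σ i * σ (i + 1) * σ i = σ (i + 1) * σ i * σ (i + 1))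
    (hfar : ∀ i j, 1 ≤ i → 1 ≤ j → i ≤ n - 1 → j ≤ n - 1 → i + 1 < j →
      σ i * σ j = σ j * σ i)
    (hκσ : ∀ i, 1 ≤ i → i ≤ n - 1 →
      σ i * κ i = μ • κ i ∧ κ i * σ i = μ • κ i)
    (hκσκ : ∀ i, 1 ≤ i → i + 1 ≤ n - 1 →
      κ i * (σ (i + 1) * κ i) = μ⁻¹ • κ i ∧
      κ i * (σinv (i + 1) * κ i) = μ • κ i ∧
      κ (i + 1) * (σ i * κ (i + 1)) = μ⁻¹ • κ (i + 1) ∧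
      κ (i + 1) * (σinv i * κ (i + 1)) = μ • κ (i + 1)) :
    ∀ (ε : ℤ), (ε = 1 ∨ ε = -1) →
    ∀ (α : ℂ), α = -(ε : ℂ) * q ^ (-ε) * μ⁻¹ →
    ∀ (bax : ℕ → ℂ → A),
      (∀ i x, bax i x =
        1 + ((x - 1) / (q - q⁻¹)) • σ i + ((x - 1) / (α * x + 1)) • κ i) →
    ∀ (x y : ℂ), α * x + 1 ≠ 0 → α * y + 1 ≠ 0 → α * (x * y) + 1 ≠ 0 →
    ∀ i, 1 ≤ i → i + 1 ≤ n - 1 →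
      bax i x * bax (i + 1) (x * y) * bax i y =
      bax (i + 1) y * bax i (x * y) * bax (i + 1) x := by
  intro ε hε α hα bax hbax x y hx hy hxy i hi1 hi2
  have hl : q - q⁻¹ ≠ 0 := by
    intro h
    have h1 : (q - 1) * (q + 1) = 0 := by
      field_simp at h
      linear_combination h
    rcases mul_eq_zero.1 h1 with h2 | h2
    · exact hq1 (by linear_combination h2)
    · exact hq2 (by linear_combination h2)
  have hαq : α ^ 2 * μ ^ 2 = (q - q⁻¹) * μ * α + 1 := by
    rcases hε with rfl | rfl
    · subst hα
      simp
      field_simp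
      ring
    · subst hα
      simp
      field_simp
      ring
  have hK : ∀ j, 1 ≤ j → j ≤ n - 1 →
      (μ * (q - q⁻¹)) • κ j = 1 + (q - q⁻¹) • σ j - σ j * σ j := by
    intro j h1 h2
    rw [hκ j h1 h2, smul_smul, mul_inv_cancel₀ (mul_ne_zero hμ0 hl), one_smul]
    simp only [mul_add, sub_mul, smul_mul_assoc, mul_smul_comm, one_mul, mul_one, smul_smul]
    match_scalars <;> field_simp <;> ring
  have hk := hK i hi1 (by omega)
  have hm := hK (i + 1) (by omega) hi2
  obtain ⟨ha, ha2⟩ := hinv i hi1 (by omega)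
  obtain ⟨hb, hb2⟩ := hinv (i + 1) (by omega) hi2
  obtain ⟨hak, hka⟩ := hκσ i hi1 (by omega)
  obtain ⟨hbm, hmb⟩ := hκσ (i + 1) (by omega) hi2
  obtain ⟨c1, c2, c3, c4⟩ := hκσκ i hi1 hi2
  have hbr := hbraid i hi1 hi2
  simp only [hbax]
  exact bmw_core _ μ α x y hl hμ0 hx hy hxy hαq _ _ _ _ _ _ hb hb2 ha ha2 hk hm hbr
    hak hka hbm hmb c1 c2 c3 c4
end

section
/- Let {X,F} and {Y,F} be compatible pairs of skew invertible operators on V⊗V. Then F₁₂ (C_X)₁ (C_Y)₂ = (C_Y)₁ (C_X)₂ F₁₂ and F₁₂ (C_X D_Y)₂ = (C_X D_Y)₁ F₁₂. -/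
noncomputable section
open Matrix BigOperators

/-- Operators on `V ⊗ V`, as matrices indexed by pairs. -/
abbrev TwoLeg (N : ℕ) (R : Type) := Matrix (Fin N × Fin N) (Fin N × Fin N) R

/-- Operators on `V ⊗ V ⊗ V`. -/
abbrev ThreeLeg (N : ℕ) (R : Type) :=
  Matrix (Fin N × Fin N × Fin N) (Fin N × Fin N × Fin N) R

variable {N : ℕ} {R : Type} [Ring R]

/-- `X₁₂` acting on legs 1,2 of three tensor factors. -/
def leg12 (X : TwoLeg N R) : ThreeLeg N R := fun p q =>
  X (p.1, p.2.1) (q.1, q.2.1) * (if p.2.2 = q.2.2 then 1 else 0)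

/-- `X₂₃` acting on legs 2,3. -/
def leg23 (X : TwoLeg N R) : ThreeLeg N R := fun p q =>
  X (p.2.1, p.2.2) (q.2.1, q.2.2) * (if p.1 = q.1 then 1 else 0)

/-- `X₁₃` acting on legs 1,3. -/
def leg13 (X : TwoLeg N R) : ThreeLeg N R := fun p q =>
  X (p.1, p.2.2) (q.1, q.2.2) * (if p.2.1 = q.2.1 then 1 else 0)

/-- Partial trace of a three-leg operator over the middle leg. -/
def ptrMid (Y : ThreeLeg N R) : TwoLeg N R := fun p q =>
  ∑ k : Fin N, Y (p.1, k, p.2) (q.1, k, q.2)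

/-- Partial trace of a two-leg operator over leg 1. -/
def trLeg1 (X : TwoLeg N R) : Matrix (Fin N) (Fin N) R := fun i j =>
  ∑ k : Fin N, X (k, i) (k, j)

/-- Partial trace of a two-leg operator over leg 2. -/
def trLeg2 (X : TwoLeg N R) : Matrix (Fin N) (Fin N) R := fun i j =>
  ∑ k : Fin N, X (i, k) (j, k)

/-- `C₁`: a one-leg operator acting on the first leg. -/
def leg1 (C : Matrix (Fin N) (Fin N) R) : TwoLeg N R := fun p q =>
  C p.1 q.1 * (if p.2 = q.2 then 1 else 0)

/-- `C₂`: a one-leg operator acting on the second leg. -/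
def leg2 (C : Matrix (Fin N) (Fin N) R) : TwoLeg N R := fun p q =>
  C p.2 q.2 * (if p.1 = q.1 then 1 else 0)

/-- The permutation operator `P₁₃` (on the two remaining legs). -/
def permP (N : ℕ) (R : Type) [Ring R] : TwoLeg N R := fun p q =>
  if p.1 = q.2 ∧ p.2 = q.1 then 1 else 0

/-- `X` is skew invertible with skew inverse `Ψ`:
`Tr₂(X₁₂ Ψ₂₃) = Tr₂(Ψ₁₂ X₂₃) = P₁₃`. -/
def IsSkewInverse (X Ψ : TwoLeg N R) : Prop :=
  ptrMid (leg12 X * leg23 Ψ) = permP N R ∧ ptrMid (leg12 Ψ * leg23 X) = permP N R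

/-- `{X,F}` is a compatible pair: `X₁F₂F₁ = F₂F₁X₂` and `X₂F₁F₂ = F₁F₂X₁`. -/
def IsCompatiblePair (X F : TwoLeg N R) : Prop :=
  leg12 X * leg23 F * leg12 F = leg23 F * leg12 F * leg23 X ∧
  leg23 X * leg12 F * leg23 F = leg12 F * leg23 F * leg12 X

/-- `X₂₁ = P X P`. -/
def swapLegs (X : TwoLeg N R) : TwoLeg N R := fun p q => X (p.2, p.1) (q.2, q.1)

end

open Matrix

namespace CCAux

variable {N : ℕ}

theorem mv3 (f : Fin N → Fin N → Fin N → ℂ) :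
    ∑ a, ∑ b, ∑ c, f a b c = ∑ c, ∑ a, ∑ b, f a b c := by
  rw [Finset.sum_congr rfl fun a _ => Finset.sum_comm]
  exact Finset.sum_comm

theorem mv4 (f : Fin N → Fin N → Fin N → Fin N → ℂ) :
    ∑ a, ∑ b, ∑ c, ∑ d, f a b c d = ∑ d, ∑ a, ∑ b, ∑ c, f a b c d := by
  rw [Finset.sum_congr rfl fun a _ => mv3 _]
  exact Finset.sum_comm

theorem mv5 (f : Fin N → Fin N → Fin N → Fin N → Fin N → ℂ) :
    ∑ a, ∑ b, ∑ c, ∑ d, ∑ e, f a b c d e = ∑ e, ∑ a, ∑ b, ∑ c, ∑ d, f a b c d e := by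
  rw [Finset.sum_congr rfl fun a _ => mv4 _]
  exact Finset.sum_comm

theorem mv6 (f : Fin N → Fin N → Fin N → Fin N → Fin N → Fin N → ℂ) :
    ∑ a, ∑ b, ∑ c, ∑ d, ∑ e, ∑ x, f a b c d e x =
      ∑ x, ∑ a, ∑ b, ∑ c, ∑ d, ∑ e, f a b c d e x := by
  rw [Finset.sum_congr rfl fun a _ => mv5 _]
  exact Finset.sum_comm

theorem mv7 (f : Fin N → Fin N → Fin N → Fin N → Fin N → Fin N → Fin N → ℂ) :
    ∑ a, ∑ b, ∑ c, ∑ d, ∑ e, ∑ x, ∑ y, f a b c d e x y =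
      ∑ y, ∑ a, ∑ b, ∑ c, ∑ d, ∑ e, ∑ x, f a b c d e x y := by
  rw [Finset.sum_congr rfl fun a _ => mv6 _]
  exact Finset.sum_comm

theorem killR {X P : TwoLeg N ℂ} (h : IsSkewInverse X P) (g : Fin N → Fin N → ℂ) (d d' : Fin N) :
    ∑ b, ∑ c, (∑ s, ∑ t, g s t * X (s, b) (t, c)) * P (c, d) (b, d') = g d' d := by
  have key : ∀ s t, ∑ b, ∑ c, X (s, b) (t, c) * P (c, d) (b, d') =
      if s = d' ∧ d = t then 1 else 0 := by
    intro s t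
    have := congrFun (congrFun h.1 (s, d)) (t, d')
    simpa [ptrMid, leg12, leg23, permP, Matrix.mul_apply, Fintype.sum_prod_type] using this
  have : ∑ b, ∑ c, (∑ s, ∑ t, g s t * X (s, b) (t, c)) * P (c, d) (b, d') =
      ∑ s, ∑ t, g s t * ∑ b, ∑ c, X (s, b) (t, c) * P (c, d) (b, d') := by
    simp only [Finset.mul_sum, Finset.sum_mul]
    rw [mv3]
    refine Finset.sum_congr rfl fun s _ => ?_
    rw [mv3]
    refine Finset.sum_congr rfl fun t _ => ?_
    refine Finset.sum_congr rfl fun b _ => Finset.sum_congr rfl fun c _ => ?_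
    ring
  rw [this]
  simp [key, ite_and]

theorem killL {X P : TwoLeg N ℂ} (h : IsSkewInverse X P) (g : Fin N → Fin N → ℂ) (e e' : Fin N) :
    ∑ p, ∑ q, P (e, p) (e', q) * (∑ b, ∑ c, X (q, b) (p, c) * g b c) = g e' e := by
  have key : ∀ b c, ∑ p, ∑ q, P (e, p) (e', q) * X (q, b) (p, c) =
      if e = c ∧ b = e' then 1 else 0 := by
    intro b c
    have := congrFun (congrFun h.2 (e, b)) (e', c)
    simpa [ptrMid, leg12, leg23, permP, Matrix.mul_apply, Fintype.sum_prod_type] using this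
  have : ∑ p, ∑ q, P (e, p) (e', q) * (∑ b, ∑ c, X (q, b) (p, c) * g b c) =
      ∑ b, ∑ c, g b c * ∑ p, ∑ q, P (e, p) (e', q) * X (q, b) (p, c) := by
    simp only [Finset.mul_sum]
    rw [mv3]
    refine Finset.sum_congr rfl fun s _ => ?_
    rw [mv3]
    refine Finset.sum_congr rfl fun t _ => ?_
    refine Finset.sum_congr rfl fun b _ => Finset.sum_congr rfl fun c _ => ?_
    ring
  rw [this]
  simp [key, ite_and]

/-- Component form of `X₁F₂F₁ = F₂F₁X₂`. -/
theorem comp {X F : TwoLeg N ℂ}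
    (h : leg12 X * leg23 F * leg12 F = leg23 F * leg12 F * leg23 X)
    (u1 u2 u3 l1 l2 l3 : Fin N) :
    ∑ w, ∑ v, (∑ t, X (u1, u2) (t, w) * F (t, v) (l1, l2)) * F (w, u3) (v, l3) =
    ∑ w, ∑ v, F (u1, w) (l1, v) * (∑ z, F (u2, u3) (w, z) * X (v, z) (l2, l3)) := by
  have := congrFun (congrFun h (u1, u2, u3)) (l1, l2, l3)
  simp [leg12, leg23, Matrix.mul_apply, Fintype.sum_prod_type, Finset.sum_mul] at this
  simp only [Finset.sum_mul, Finset.mul_sum]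
  refine Eq.trans ?_ (this.trans ?_)
  · rw [mv3]
    refine Finset.sum_congr rfl fun t _ => ?_
    rw [Finset.sum_comm]
    refine Finset.sum_congr rfl fun v _ => Finset.sum_congr rfl fun w _ => ?_
    ring
  · rw [mv3]
    refine Finset.sum_congr rfl fun w _ => Finset.sum_congr rfl fun v _ =>
      Finset.sum_congr rfl fun z _ => ?_
    ring

theorem e1 {X F PF : TwoLeg N ℂ} (hF : IsSkewInverse F PF)
    (h : leg12 X * leg23 F * leg12 F = leg23 F * leg12 F * leg23 X)
    (u0 u2 u4 l0 l2 l4 : Fin N) :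
    ∑ s, ∑ t, (∑ r, PF (u0, r) (l0, s) * F (t, u4) (r, l2)) * X (s, u2) (t, l4) =
    ∑ b, ∑ c, X (u0, b) (l2, c) * (∑ a, F (u2, a) (l0, b) * PF (c, u4) (a, l4)) := by
  have h1 : ∀ u1 l1, ∑ t, X (u1, u2) (t, l4) * F (t, u4) (l1, l2) =
      ∑ w, ∑ v, F (u1, w) (l1, v) *
        (∑ u3, ∑ l3, ∑ z, F (u2, u3) (w, z) * X (v, z) (l2, l3) * PF (l3, u4) (u3, l4)) := by
    intro u1 l1
    have := killR hF (fun w v => ∑ t, X (u1, u2) (t, w) * F (t, v) (l1, l2)) u4 l4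
    rw [← this]
    simp only [comp h]
    simp only [Finset.sum_mul, Finset.mul_sum]
    rw [mv3]
    refine Finset.sum_congr rfl fun w _ => ?_
    rw [mv3]
    refine Finset.sum_congr rfl fun v _ => ?_
    refine Finset.sum_congr rfl fun b _ => Finset.sum_congr rfl fun c _ => ?_
    refine Finset.sum_congr rfl fun z _ => ?_
    ring
  have h2 := killL hF (fun w v => ∑ u3, ∑ l3, ∑ z,
    F (u2, u3) (w, z) * X (v, z) (l2, l3) * PF (l3, u4) (u3, l4)) u0 l0
  simp only [← h1] at h2
  simp only [Finset.sum_mul, Finset.mul_sum] at h2 ⊢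
  calc _ = _ := ?_
    _ = _ := h2
    _ = _ := ?_
  · rw [mv3]
    refine Finset.sum_congr rfl fun r _ => Finset.sum_congr rfl fun s _ =>
      Finset.sum_congr rfl fun t _ => ?_
    ring
  · rw [mv3]
    refine Finset.sum_congr rfl fun z _ => ?_
    rw [Finset.sum_comm]
    refine Finset.sum_congr rfl fun c _ => Finset.sum_congr rfl fun a _ => ?_
    ring

theorem e2 {X PX F PF : TwoLeg N ℂ} (hX : IsSkewInverse X PX) (hF : IsSkewInverse F PF)
    (h : leg12 X * leg23 F * leg12 F = leg23 F * leg12 F * leg23 X)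
    (d d' e e' u4 l0 : Fin N) :
    ∑ l2, ∑ u0, PX (e, l2) (e', u0) * (∑ r, PF (u0, r) (l0, d') * F (d, u4) (r, l2)) =
    ∑ u2, ∑ l4, (∑ a, F (u2, a) (l0, e') * PF (e, u4) (a, l4)) * PX (l4, d) (u2, d') := by
  have h1 : ∀ u0 l2, ∑ r, PF (u0, r) (l0, d') * F (d, u4) (r, l2) =
      ∑ b, ∑ c, X (u0, b) (l2, c) * (∑ u2, ∑ l4,
        (∑ a, F (u2, a) (l0, b) * PF (c, u4) (a, l4)) * PX (l4, d) (u2, d')) := by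
    intro u0 l2
    rw [← killR hX (fun s t => ∑ r, PF (u0, r) (l0, s) * F (t, u4) (r, l2)) d d']
    simp only [e1 hF h]
    simp only [Finset.sum_mul, Finset.mul_sum]
    rw [mv3]
    refine Finset.sum_congr rfl fun w _ => ?_
    rw [mv3]
    refine Finset.sum_congr rfl fun v _ => ?_
    refine Finset.sum_congr rfl fun b _ => Finset.sum_congr rfl fun c _ => ?_
    refine Finset.sum_congr rfl fun z _ => ?_
    ring
  simp only [h1]
  exact killL hX (fun b c => ∑ u2, ∑ l4,
        (∑ a, F (u2, a) (l0, b) * PF (c, u4) (a, l4)) * PX (l4, d) (u2, d')) e e'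

theorem e3 {X PX F PF : TwoLeg N ℂ} (hX : IsSkewInverse X PX) (hF : IsSkewInverse F PF)
    (h : leg12 X * leg23 F * leg12 F = leg23 F * leg12 F * leg23 X) :
    F * leg2 (trLeg1 PX) * swapLegs PF = leg1 (trLeg1 PX) := by
  ext ⟨d, u⟩ ⟨d', l⟩
  have h1 : ∑ e, ∑ l2, ∑ u0,
        PX (e, l2) (e, u0) * (∑ r, PF (u0, r) (l, d') * F (d, u) (r, l2)) = 
      ∑ e, ∑ u2, ∑ l4, (∑ a, F (u2, a) (l, e) * PF (e, u) (a, l4)) * PX (l4, d) (u2, d') :=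
    Finset.sum_congr rfl fun e _ => e2 hX hF h d d' e e u l
  have key : ∀ u2 l4, ∑ a, ∑ e, F (u2, a) (l, e) * PF (e, u) (a, l4) =
      if u2 = l4 ∧ u = l then 1 else 0 := by
    intro s t
    have := congrFun (congrFun hF.1 (s, u)) (l, t)
    simpa [ptrMid, leg12, leg23, permP, Matrix.mul_apply, Fintype.sum_prod_type] using this
  have h2 : ∑ e, ∑ u2, ∑ l4, (∑ a, F (u2, a) (l, e) * PF (e, u) (a, l4)) * PX (l4, d) (u2, d') =
      ∑ u2, ∑ l4, (∑ a, ∑ e, F (u2, a) (l, e) * PF (e, u) (a, l4)) * PX (l4, d) (u2, d') := by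
    simp only [Finset.sum_mul]
    rw [Finset.sum_comm]
    refine Finset.sum_congr rfl fun u2 _ => ?_
    rw [Finset.sum_comm]
    refine Finset.sum_congr rfl fun l4 _ => ?_
    rw [Finset.sum_comm]
  rw [h2] at h1
  simp only [key] at h1
  have h3 : leg1 (trLeg1 PX) (d, u) (d', l) = ∑ u2, ∑ l4,
      (if u2 = l4 ∧ u = l then 1 else 0) * PX (l4, d) (u2, d') := by
    by_cases hul : u = l <;> simp [leg1, trLeg1, hul]
  rw [h3, ← h1]
  simp [Matrix.mul_apply, Fintype.sum_prod_type, leg2, trLeg1, swapLegs, Finset.sum_mul,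
    Finset.mul_sum]
  rw [mv4]
  refine Finset.sum_congr rfl fun e _ => ?_
  rw [mv3]
  refine Finset.sum_congr rfl fun p _ => ?_
  rw [Finset.sum_comm]
  refine Finset.sum_congr rfl fun q _ => Finset.sum_congr rfl fun r _ => ?_
  ring

theorem e4 {X PX F PF : TwoLeg N ℂ} (hX : IsSkewInverse X PX) (hF : IsSkewInverse F PF)
    (h : leg12 X * leg23 F * leg12 F = leg23 F * leg12 F * leg23 X) :
    swapLegs PF * leg1 (trLeg2 PX) * F = leg2 (trLeg2 PX) := by
  ext ⟨u, e⟩ ⟨l, e'⟩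
  have h1 : ∑ d, ∑ l2, ∑ u0,
        PX (e, l2) (e', u0) * (∑ r, PF (u0, r) (l, d) * F (d, u) (r, l2)) = 
      ∑ d, ∑ u2, ∑ l4, (∑ a, F (u2, a) (l, e') * PF (e, u) (a, l4)) * PX (l4, d) (u2, d) :=
    Finset.sum_congr rfl fun d _ => e2 hX hF h d d e e' u l
  have key : ∀ u0 l2, ∑ r, ∑ d, PF (u0, r) (l, d) * F (d, u) (r, l2) =
      if u0 = l2 ∧ u = l then 1 else 0 := by
    intro s t
    have := congrFun (congrFun hF.2 (s, u)) (l, t)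
    simpa [ptrMid, leg12, leg23, permP, Matrix.mul_apply, Fintype.sum_prod_type] using this
  have h2 : ∑ d, ∑ l2, ∑ u0,
        PX (e, l2) (e', u0) * (∑ r, PF (u0, r) (l, d) * F (d, u) (r, l2)) =
      ∑ l2, ∑ u0,
        PX (e, l2) (e', u0) * (∑ r, ∑ d, PF (u0, r) (l, d) * F (d, u) (r, l2)) := by
    simp only [Finset.mul_sum]
    rw [Finset.sum_comm]
    refine Finset.sum_congr rfl fun u2 _ => ?_
    rw [Finset.sum_comm]
    refine Finset.sum_congr rfl fun l4 _ => ?_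
    rw [Finset.sum_comm]
  rw [h2] at h1
  simp only [key] at h1
  have h3 : leg2 (trLeg2 PX) (u, e) (l, e') = ∑ l2, ∑ u0,
      PX (e, l2) (e', u0) * (if u0 = l2 ∧ u = l then 1 else 0) := by
    by_cases hul : u = l <;> simp [leg2, trLeg2, hul]
  rw [h3, h1]
  simp [Matrix.mul_apply, Fintype.sum_prod_type, leg1, trLeg2, swapLegs, Finset.sum_mul,
    Finset.mul_sum]
  rw [mv4]
  refine Finset.sum_congr rfl fun d _ => Finset.sum_congr rfl fun q _ => ?_
  rw [Finset.sum_comm]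
  refine Finset.sum_congr rfl fun p _ => Finset.sum_congr rfl fun a _ => ?_
  ring

theorem swap_skew {X P : TwoLeg N ℂ} (h : IsSkewInverse X P) :
    IsSkewInverse (swapLegs X) (swapLegs P) := by
  constructor
  · ext ⟨a, b⟩ ⟨c, d⟩
    have := congrFun (congrFun h.2 (b, a)) (d, c)
    simp [ptrMid, leg12, leg23, permP, Matrix.mul_apply, Fintype.sum_prod_type, swapLegs] at this ⊢
    rw [Finset.sum_comm]
    refine Eq.trans ?_ (this.trans (if_congr and_comm rfl rfl))
    refine Finset.sum_congr rfl fun p _ => Finset.sum_congr rfl fun q _ => ?_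
    ring
  · ext ⟨a, b⟩ ⟨c, d⟩
    have := congrFun (congrFun h.1 (b, a)) (d, c)
    simp [ptrMid, leg12, leg23, permP, Matrix.mul_apply, Fintype.sum_prod_type, swapLegs] at this ⊢
    rw [Finset.sum_comm]
    refine Eq.trans ?_ (this.trans (if_congr and_comm rfl rfl))
    refine Finset.sum_congr rfl fun p _ => Finset.sum_congr rfl fun q _ => ?_
    ring

/-- Reversal of the three legs. -/
def rev : (Fin N × Fin N × Fin N) ≃ (Fin N × Fin N × Fin N) where
  toFun p := (p.2.2, p.2.1, p.1)
  invFun p := (p.2.2, p.2.1, p.1)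
  left_inv _ := rfl
  right_inv _ := rfl

theorem rev12 (X : TwoLeg N ℂ) : (leg12 X).submatrix rev rev = leg23 (swapLegs X) := by
  ext ⟨a, b, c⟩ ⟨d, e, f⟩
  simp [leg12, leg23, swapLegs, rev]

theorem rev23 (X : TwoLeg N ℂ) : (leg23 X).submatrix rev rev = leg12 (swapLegs X) := by
  ext ⟨a, b, c⟩ ⟨d, e, f⟩
  simp [leg12, leg23, swapLegs, rev]

theorem swap_comp {X F : TwoLeg N ℂ}
    (h : leg23 X * leg12 F * leg23 F = leg12 F * leg23 F * leg12 X) :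
    leg12 (swapLegs X) * leg23 (swapLegs F) * leg12 (swapLegs F) =
      leg23 (swapLegs F) * leg12 (swapLegs F) * leg23 (swapLegs X) := by
  simp only [← rev12, ← rev23, Matrix.submatrix_mul_equiv, h]

theorem swap_mul (A B : TwoLeg N ℂ) : swapLegs (A * B) = swapLegs A * swapLegs B := by
  ext ⟨a, b⟩ ⟨c, d⟩
  simp only [swapLegs, Matrix.mul_apply, Fintype.sum_prod_type]
  exact Finset.sum_comm

theorem leg12_comm (A B : Matrix (Fin N) (Fin N) ℂ) : leg1 A * leg2 B = leg2 B * leg1 A := by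
  ext ⟨a, b⟩ ⟨c, d⟩
  simp [leg1, leg2, Matrix.mul_apply, Fintype.sum_prod_type, mul_comm]

theorem leg1_mul (A B : Matrix (Fin N) (Fin N) ℂ) : leg1 (A * B) = leg1 A * leg1 B := by
  ext ⟨a, b⟩ ⟨c, d⟩
  simp [leg1, Matrix.mul_apply, Fintype.sum_prod_type]

theorem leg2_mul (A B : Matrix (Fin N) (Fin N) ℂ) : leg2 (A * B) = leg2 A * leg2 B := by
  ext ⟨a, b⟩ ⟨c, d⟩
  simp [leg2, Matrix.mul_apply, Fintype.sum_prod_type]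

theorem e4' {X PX F PF : TwoLeg N ℂ} (hX : IsSkewInverse X PX) (hF : IsSkewInverse F PF)
    (h : leg23 X * leg12 F * leg23 F = leg12 F * leg23 F * leg12 X) :
    swapLegs PF * leg2 (trLeg1 PX) * F = leg1 (trLeg1 PX) := by
  have := congrArg swapLegs (e4 (swap_skew hX) (swap_skew hF) (swap_comp h))
  rw [swap_mul, swap_mul] at this
  exact this

end CCAux

/-- Corollary 3.4 (partial): for compatible pairs `{X,F}` and `{Y,F}` of skew
invertible operators, `F₁₂ (C_X)₁ (C_Y)₂ = (C_Y)₁ (C_X)₂ F₁₂` and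
`F₁₂ (C_X D_Y)₂ = (C_X D_Y)₁ F₁₂`. -/
theorem compatible_pair_CC_CD_relations
    {N : ℕ} (X ΨX Y ΨY F ΨF : TwoLeg N ℂ)
    (hX : IsSkewInverse X ΨX) (hY : IsSkewInverse Y ΨY) (hF : IsSkewInverse F ΨF)
    (hXF : IsCompatiblePair X F) (hYF : IsCompatiblePair Y F) :
    F * leg1 (trLeg1 ΨX) * leg2 (trLeg1 ΨY) =
      leg1 (trLeg1 ΨY) * leg2 (trLeg1 ΨX) * F ∧
    F * leg2 (trLeg1 ΨX * trLeg2 ΨY) = leg1 (trLeg1 ΨX * trLeg2 ΨY) * F := by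
  have c1 := CCAux.e3 hY hF hYF.1
  have c2 := CCAux.e4' hX hF hXF.2
  have c3 := CCAux.e3 hX hF hXF.1
  have c4 := CCAux.e4 hY hF hYF.1
  constructor
  · calc F * leg1 (trLeg1 ΨX) * leg2 (trLeg1 ΨY)
        = F * (leg2 (trLeg1 ΨY) * leg1 (trLeg1 ΨX)) := by
          rw [Matrix.mul_assoc, CCAux.leg12_comm]
      _ = F * leg2 (trLeg1 ΨY) * swapLegs ΨF * leg2 (trLeg1 ΨX) * F := by
          rw [← c2]; simp only [Matrix.mul_assoc]
      _ = _ := by rw [c1]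
  · rw [CCAux.leg2_mul, CCAux.leg1_mul, ← c4, ← c3]
    simp only [Matrix.mul_assoc]
end
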